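/- (Extended Källén–Lehmann expansion.) Let d > 1 be real and set δ = (d−1)/2. Let λ, ν be real such that none of λ+ν, δ+λ, δ+ν, δ+λ+ν, 2δ+λ+ν is a nonpositive integer, and neither λ nor ν is a negative integer. Then for every real u > 1 the series Σ_{k=0}^∞ ρ(d,k,λ,ν)·G(d, δ+2k+λ+ν, u) converges absolutely and G(d,λ,u)·G(d,ν,u) = Σ_{k=0}^∞ ρ(d,k,λ,ν)·G(d, δ+2k+λ+ν, u). (In particular, the expansion holds without the positivity conditions λ+1 > 0, ν+1 > 0, λ+ν+1 ≥ 0.) -/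

import Mathlib

open MeasureTheory Real Filter

/-- The AdS propagator, defined for real parameters `d`, `μ` and real `u > 1` by its
hypergeometric series. -/
noncomputable def adsG (d μ u : ℝ) : ℝ :=
  Real.Gamma ((d - 1) / 2 + μ) /
      (2 * Real.pi ^ ((d - 1) / 2) * Real.Gamma (μ + 1) * (2 * u) ^ ((d - 1) / 2 + μ)) *
    ∑' n : ℕ,
      (ascPochhammer ℝ n).eval ((d - 1) / 4 + μ / 2) *
          (ascPochhammer ℝ n).eval ((d + 1) / 4 + μ / 2) /
          ((ascPochhammer ℝ n).eval (μ + 1) * (n.factorial : ℝ)) *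
        u ^ (-(2 : ℝ) * n)

/-- The Källén–Lehmann weight `ρ(d,k,λ,ν)`. -/
noncomputable def klWeight (d : ℝ) (k : ℕ) (l v : ℝ) : ℝ :=
  (2 * ((d - 1) / 2) + 4 * k + 2 * l + 2 * v) * Real.Gamma (1 + 2 * k + l + v) /
      (4 * Real.pi ^ ((d - 1) / 2) * Real.Gamma ((d - 1) / 2) *
        Real.Gamma (2 * ((d - 1) / 2) + 2 * k + l + v)) *
    (Real.Gamma ((d - 1) / 2 + k) * Real.Gamma ((d - 1) / 2 + l + k) *
        Real.Gamma ((d - 1) / 2 + v + k) * Real.Gamma ((d - 1) / 2 + l + v + k) /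
      (Real.Gamma (1 + k) * Real.Gamma (1 + l + k) * Real.Gamma (1 + v + k) *
        Real.Gamma (1 + l + v + k)))

/-- The rising factorial `(x)_n`. -/
noncomputable def poch (x : ℝ) (n : ℕ) : ℝ := (ascPochhammer ℝ n).eval x

@[simp] lemma poch_zero (x : ℝ) : poch x 0 = 1 := by simp [poch]

lemma poch_succ (x : ℝ) (n : ℕ) : poch x (n + 1) = poch x n * (x + n) :=
  ascPochhammer_succ_eval n x

lemma poch_add (x : ℝ) (m n : ℕ) : poch x (m + n) = poch x m * poch (x + m) n := by
  induction n with
  | zero => simp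
  | succ n ih => rw [← add_assoc, poch_succ, ih, poch_succ]; push_cast; ring

lemma poch_succ_left (x : ℝ) (n : ℕ) : poch x (n + 1) = x * poch (x + 1) n := by
  rw [add_comm, poch_add, poch_succ]; simp

lemma mul_poch_add_one (x : ℝ) (n : ℕ) : x * poch (x + 1) n = poch x n * (x + n) := by
  rw [← poch_succ_left, poch_succ]

lemma poch_ne_zero {x : ℝ} (hx : ∀ m : ℕ, x ≠ -m) (n : ℕ) : poch x n ≠ 0 := by
  induction n with
  | zero => simp
  | succ n ih =>
    rw [poch_succ]
    exact mul_ne_zero ih fun h => hx n (by linarith)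

lemma poch_pos {x : ℝ} (hx : 0 < x) (n : ℕ) : 0 < poch x n := ascPochhammer_pos n x hx

lemma poch_zero_succ (n : ℕ) : poch 0 (n + 1) = 0 := by rw [poch_succ_left]; simp

/-- `(x)_{2n} = 4^n (x/2)_n ((x+1)/2)_n`. -/
lemma poch_two_mul (x : ℝ) (n : ℕ) :
    poch x (2 * n) = 4 ^ n * (poch (x / 2) n * poch ((x + 1) / 2) n) := by
  induction n with
  | zero => simp
  | succ n ih =>
    rw [show 2 * (n + 1) = 2 * n + 1 + 1 by ring, poch_succ, poch_succ, ih, poch_succ, poch_succ]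
    push_cast; ring

@[fun_prop] lemma continuous_poch (n : ℕ) : Continuous fun x => poch x n :=
  (ascPochhammer ℝ n).continuous

lemma Gamma_add_natCast {x : ℝ} (hx : ∀ m : ℕ, x ≠ -m) (n : ℕ) :
    Real.Gamma (x + n) = Real.Gamma x * poch x n := by
  induction n with
  | zero => simp
  | succ n ih =>
    rw [Nat.cast_succ, ← add_assoc, Real.Gamma_add_one fun h => hx n (by linarith), ih, poch_succ]
    ring

/-- Coefficient of `(2u)^(-2n)` in the propagator of parameter `μ`, normalized to `1` at `n = 0`. -/
noncomputable def propCoeff (δ μ : ℝ) (n : ℕ) : ℝ :=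
  poch (δ + μ) (2 * n) / (poch (μ + 1) n * n.factorial)

/-- The Källén–Lehmann weight, normalized to `1` at `k = 0`. -/
noncomputable def klCoeff (δ l v : ℝ) (k : ℕ) : ℝ :=
  poch δ k * poch (δ + l) k * poch (δ + v) k * poch (l + v + 1 + k) k /
    (k.factorial * poch (l + 1) k * poch (v + 1) k * poch (δ + l + v + k) k)

@[simp] lemma propCoeff_zero (δ μ : ℝ) : propCoeff δ μ 0 = 1 := by simp [propCoeff]

@[simp] lemma klCoeff_zero (δ l v : ℝ) : klCoeff δ l v 0 = 1 := by simp [klCoeff]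

/-- The coefficient in the contiguity relation of the propagators. -/
noncomputable def contigCoeff (δ μ : ℝ) : ℝ := (δ + μ) * (μ + 1 - δ) / (μ * (μ + 1))

lemma propCoeff_contiguous (δ : ℝ) {μ : ℝ} (hμ : ∀ m : ℕ, μ ≠ -m) (n : ℕ) :
    propCoeff δ μ (n + 1) =
      propCoeff δ (μ - 1) (n + 1) + contigCoeff δ μ * propCoeff δ (μ + 1) n := by
  have h0 : μ ≠ 0 := by simpa using hμ 0
  have h1 : μ + 1 ≠ 0 := fun h => hμ 1 (by push_cast; linarith)
  have h2 : μ + 1 + n ≠ 0 := fun h => hμ (n + 1) (by push_cast; linarith)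
  have hp : poch (μ + 1) n ≠ 0 :=
    poch_ne_zero (fun m h => hμ (m + 1) (by push_cast; linarith)) n
  have hp' : poch (μ + 1 + 1) n = poch (μ + 1) n * (μ + 1 + n) / (μ + 1) := by
    rw [eq_div_iff h1, ← mul_poch_add_one]; ring
  have e1 : poch (δ + μ) (2 * (n + 1)) =
      (δ + μ) * poch (δ + μ + 1) (2 * n) * (δ + μ + 1 + 2 * n) := by
    rw [show 2 * (n + 1) = 2 * n + 1 + 1 by ring, poch_succ_left, poch_succ]; push_cast; ring
  have e2 : poch (δ + (μ - 1)) (2 * (n + 1)) =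
      (δ + μ - 1) * ((δ + μ) * poch (δ + μ + 1) (2 * n)) := by
    rw [show 2 * (n + 1) = 2 * n + 1 + 1 by ring, poch_succ_left, poch_succ_left]
    ring_nf
  have e3 : poch (μ - 1 + 1) (n + 1) = μ * poch (μ + 1) n := by
    rw [sub_add_cancel, poch_succ_left]
  rw [propCoeff, propCoeff, propCoeff, contigCoeff, e1, e2, e3, poch_succ, hp', ← add_assoc δ μ 1]
  have hf : (n.factorial : ℝ) ≠ 0 := by positivity
  have hn : (n : ℝ) + 1 ≠ 0 := by positivity
  rw [Nat.factorial_succ]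
  push_cast
  field_simp
  ring

/-- No denominator in the contiguity relations vanishes. -/
def Generic (δ l v : ℝ) : Prop :=
  ∀ m : ℤ, l ≠ m ∧ v ≠ m ∧ l + v ≠ m ∧ δ + l + v ≠ m

lemma Generic.add_int {δ l v : ℝ} (h : Generic δ l v) (j : ℤ) : Generic δ (l + j) v := by
  intro m
  obtain ⟨h1, h2, h3, h4⟩ := h (m - j)
  push_cast at h1 h3 h4
  exact ⟨fun e => h1 (by linarith), (h m).2.1, fun e => h3 (by linarith),
    fun e => h4 (by linarith)⟩

lemma klCoeff_contiguous {δ l v : ℝ} (h : Generic δ l v) (k : ℕ) :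
    klCoeff δ l v (k + 1) + contigCoeff δ (δ + l + v + 2 * k) * klCoeff δ l v k =
      klCoeff δ (l - 1) v (k + 1) + contigCoeff δ l * klCoeff δ (l + 1) v k := by
  have hl (m : ℤ) : l + m ≠ 0 := fun e => (h (-m)).1 (by push_cast; linarith)
  have hv (m : ℤ) : v + m ≠ 0 := fun e => (h (-m)).2.1 (by push_cast; linarith)
  have hs (m : ℤ) : l + v + m ≠ 0 := fun e => (h (-m)).2.2.1 (by push_cast; linarith)
  have ha (m : ℤ) : δ + l + v + m ≠ 0 := fun e => (h (-m)).2.2.2 (by push_cast; linarith)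
  have l0 : l ≠ 0 := by simpa using hl 0
  have l1 : l + 1 ≠ 0 := by simpa using hl 1
  have lk : l + 1 + k ≠ 0 := by simpa [add_assoc] using hl (1 + k)
  have vk : v + 1 + k ≠ 0 := by simpa [add_assoc] using hv (1 + k)
  have sk : l + v + 1 + k ≠ 0 := by simpa [add_assoc] using hs (1 + k)
  have ak : δ + l + v + k ≠ 0 := by simpa [add_assoc] using ha k
  have ak2 : δ + l + v + 2 * k ≠ 0 := by simpa [add_assoc] using ha (2 * k)
  have ak3 : δ + l + v + 2 * k + 1 ≠ 0 := by simpa [add_assoc] using ha (2 * k + 1)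
  have pl : poch (l + 1) k ≠ 0 := poch_ne_zero
    (fun m e => hl (1 + m) (by push_cast; linarith)) k
  have pv : poch (v + 1) k ≠ 0 := poch_ne_zero
    (fun m e => hv (1 + m) (by push_cast; linarith)) k
  have pa : poch (δ + l + v + k) k ≠ 0 := poch_ne_zero
    (fun m e => ha (k + m) (by push_cast; linarith)) k
  have e1 : poch (l + v + 1 + (k + 1 : ℕ)) (k + 1) =
      poch (l + v + 1 + k) k * (l + v + 1 + 2 * k) * (l + v + 2 + 2 * k) / (l + v + 1 + k) := by
    rw [eq_div_iff sk, mul_comm, Nat.cast_succ, ← add_assoc, mul_poch_add_one, poch_succ]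
    push_cast; ring
  have e2 : poch (δ + l + v + (k + 1 : ℕ)) (k + 1) =
      poch (δ + l + v + k) k * (δ + l + v + 2 * k) * (δ + l + v + 2 * k + 1) /
        (δ + l + v + k) := by
    rw [eq_div_iff ak, mul_comm, Nat.cast_succ, ← add_assoc, mul_poch_add_one, poch_succ]
    push_cast; ring
  have e3 : poch (l - 1 + v + 1 + (k + 1 : ℕ)) (k + 1) =
      poch (l + v + 1 + k) k * (l + v + 1 + 2 * k) := by
    rw [show l - 1 + v + 1 + (k + 1 : ℕ) = l + v + 1 + k by push_cast; ring, poch_succ]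
    ring
  have e4 : poch (δ + (l - 1) + v + (k + 1 : ℕ)) (k + 1) =
      poch (δ + l + v + k) k * (δ + l + v + 2 * k) := by
    rw [show δ + (l - 1) + v + (k + 1 : ℕ) = δ + l + v + k by push_cast; ring, poch_succ]
    ring
  have e5 : poch (l + 1 + v + 1 + k) k =
      poch (l + v + 1 + k) k * (l + v + 1 + 2 * k) / (l + v + 1 + k) := by
    rw [eq_div_iff sk, mul_comm, show l + 1 + v + 1 + k = l + v + 1 + k + 1 by ring,
      mul_poch_add_one]
    ring
  have e6 : poch (δ + (l + 1) + v + k) k =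
      poch (δ + l + v + k) k * (δ + l + v + 2 * k) / (δ + l + v + k) := by
    rw [eq_div_iff ak, mul_comm, show δ + (l + 1) + v + k = δ + l + v + k + 1 by ring,
      mul_poch_add_one]
    ring
  have e7 : poch (l - 1 + 1) (k + 1) = l * poch (l + 1) k := by
    rw [sub_add_cancel, poch_succ_left]
  have e8 : poch (l + 1 + 1) k = poch (l + 1) k * (l + 1 + k) / (l + 1) := by
    rw [eq_div_iff l1, mul_comm, mul_poch_add_one]
  have e9 : poch (δ + (l - 1)) (k + 1) = (δ + l - 1) * poch (δ + l) k := by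
    rw [poch_succ_left]; ring_nf
  have e10 : (δ + l) * poch (δ + (l + 1)) k = poch (δ + l) k * (δ + l + k) := by
    rw [← mul_poch_add_one]; ring_nf
  have e11 : contigCoeff δ l * klCoeff δ (l + 1) v k = (l + 1 - δ) / (l * (l + 1)) *
      (poch δ k * ((δ + l) * poch (δ + (l + 1)) k) * poch (δ + v) k *
        poch (l + 1 + v + 1 + k) k / (k.factorial * poch (l + 1 + 1) k * poch (v + 1) k *
        poch (δ + (l + 1) + v + k) k)) := by
    rw [contigCoeff, klCoeff]; ring
  rw [e11, e10, klCoeff, klCoeff, klCoeff, contigCoeff, e1, e2, e3, e4, e5, e6, e7, e8, e9,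
    poch_succ δ, poch_succ (δ + l), poch_succ (δ + v), poch_succ (l + 1), poch_succ (v + 1),
    Nat.factorial_succ]
  have hf : (k.factorial : ℝ) ≠ 0 := by positivity
  have hn : (k : ℝ) + 1 ≠ 0 := by positivity
  push_cast
  generalize poch δ k = a1
  generalize poch (δ + l) k = a2
  generalize poch (δ + v) k = a3
  generalize poch (l + v + 1 + k) k = a4
  generalize poch (l + 1) k = b1 at *
  generalize poch (v + 1) k = b2 at *
  generalize poch (δ + l + v + k) k = b3 at *
  generalize (k.factorial : ℝ) = b4 at *
  generalize (k : ℝ) = x at *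
  clear e1 e2 e3 e4 e5 e6 e7 e8 e9 e10 e11 hl hv hs ha h
  obtain ⟨A, hA⟩ : ∃ A, A = δ + l + v + 2 * x := ⟨_, rfl⟩
  obtain rfl : δ = A - l - v - 2 * x := by linarith
  rw [show A - l - v - 2 * x + l + v + x = A - x by ring] at *
  rw [show A - l - v - 2 * x + l + v + 2 * x = A by ring] at *
  field_simp
  ring

/-- Difference of the `N`-th coefficients of the two sides of the expansion. -/
noncomputable def defect (δ l v : ℝ) (N : ℕ) : ℝ :=
  ∑ p ∈ Finset.HasAntidiagonal.antidiagonal N, propCoeff δ l p.1 * propCoeff δ v p.2 -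
    ∑ p ∈ Finset.HasAntidiagonal.antidiagonal N,
      klCoeff δ l v p.1 * propCoeff δ (δ + l + v + 2 * p.1) p.2

/-- The defect multiplied by `(l+1)_N (v+1)_N (δ+l+v)_{2N+1}`, written without denominators. -/
noncomputable def clearedDefect (δ l v : ℝ) (N : ℕ) : ℝ :=
  ∑ p ∈ Finset.HasAntidiagonal.antidiagonal N,
    poch (δ + l) (2 * p.1) * poch (δ + v) (2 * p.2) * poch (l + 1 + p.1) p.2 *
      poch (v + 1 + p.2) p.1 * poch (δ + l + v) (2 * N + 1) *
      ((p.1.factorial : ℝ) * p.2.factorial)⁻¹ -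
  ∑ p ∈ Finset.HasAntidiagonal.antidiagonal N,
    poch δ p.1 * poch (δ + l) p.1 * poch (δ + v) p.1 * poch (l + v + 1 + p.1) p.1 *
      poch (δ + (δ + l + v + 2 * p.1)) (2 * p.2) * poch (l + 1 + p.1) p.2 *
      poch (v + 1 + p.1) p.2 * poch (δ + l + v) p.1 * (δ + l + v + 2 * p.1) *
      poch (δ + l + v + 2 * p.1 + 1 + p.2) p.2 * ((p.1.factorial : ℝ) * p.2.factorial)⁻¹

lemma clearedDefect_eq {δ l v : ℝ} (hl : ∀ m : ℕ, l + 1 ≠ -m) (hv : ∀ m : ℕ, v + 1 ≠ -m)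
    (ha : ∀ m : ℕ, δ + l + v ≠ -m) (N : ℕ) :
    clearedDefect δ l v N =
      poch (l + 1) N * poch (v + 1) N * poch (δ + l + v) (2 * N + 1) * defect δ l v N := by
  rw [clearedDefect, defect, mul_sub, Finset.mul_sum, Finset.mul_sum]
  congr 1
  · refine Finset.sum_congr rfl fun p hp => ?_
    obtain ⟨i, j⟩ := p
    obtain rfl : i + j = N := by simpa using hp
    have h1 := poch_ne_zero hl i
    have h2 := poch_ne_zero hv j
    have e : poch (v + 1) (i + j) = poch (v + 1) j * poch (v + 1 + j) i := by
      rw [add_comm i j, poch_add]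
    simp only [propCoeff]
    rw [e, poch_add (l + 1)]
    field_simp
  · refine Finset.sum_congr rfl fun p hp => ?_
    obtain ⟨k, n⟩ := p
    obtain rfl : k + n = N := by simpa using hp
    have h1 := poch_ne_zero hl k
    have h2 := poch_ne_zero hv k
    have h3 : poch (δ + l + v + k) k ≠ 0 :=
      poch_ne_zero (fun m e => ha (k + m) (by push_cast; linarith)) k
    have h4 : poch (δ + l + v + 2 * k + 1) n ≠ 0 :=
      poch_ne_zero (fun m e => ha (2 * k + 1 + m) (by push_cast; linarith)) n
    have e : poch (δ + l + v) (2 * (k + n) + 1) = poch (δ + l + v) k * poch (δ + l + v + k) k *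
        (δ + l + v + 2 * k) * poch (δ + l + v + 2 * k + 1) n *
        poch (δ + l + v + 2 * k + 1 + n) n := by
      rw [show 2 * (k + n) + 1 = k + k + 1 + n + n by ring, poch_add, poch_add, poch_succ, poch_add]
      push_cast
      rw [show δ + l + v + (k + k + 1 + n) = δ + l + v + 2 * k + 1 + n by ring,
        show δ + l + v + (k + k + 1) = δ + l + v + 2 * k + 1 by ring]
      ring
    simp only [propCoeff, klCoeff]
    rw [e, poch_add (l + 1), poch_add (v + 1)]
    generalize poch (δ + l + v + 2 * k + 1 + n) n = c1
    generalize poch (δ + l + v + 2 * k + 1) n = c2 at *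
    generalize poch (δ + l + v + k) k = c3 at *
    generalize poch (l + 1) k = c4 at *
    generalize poch (v + 1) k = c5 at *
    generalize poch (δ + (δ + l + v + 2 * k)) (2 * n) = c6
    generalize poch (l + 1 + k) n = c7
    generalize poch (v + 1 + k) n = c8
    generalize poch (l + v + 1 + k) k = c9
    generalize δ + l + v + 2 * (k : ℝ) = c10
    field_simp

lemma defect_zero (δ l v : ℝ) : defect δ l v 0 = 0 := by simp [defect]

/-- At `l = -δ` the propagator of parameter `l` is constant and the expansion is trivial. -/
lemma defect_neg (δ v : ℝ) (N : ℕ) : defect δ (-δ) v N = 0 := by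
  cases N with
  | zero => exact defect_zero _ _ _
  | succ N =>
    have h1 (n : ℕ) : propCoeff δ (-δ) (n + 1) = 0 := by
      rw [propCoeff, add_neg_cancel, show 2 * (n + 1) = 2 * n + 1 + 1 by ring, poch_zero_succ,
        zero_div]
    have h2 (n : ℕ) : klCoeff δ (-δ) v (n + 1) = 0 := by
      rw [klCoeff, add_neg_cancel, poch_zero_succ]; simp
    rw [defect, Finset.Nat.sum_antidiagonal_succ, Finset.Nat.sum_antidiagonal_succ]
    simp [h1, h2]

lemma defect_succ {δ l v : ℝ} (h : Generic δ l v) (N : ℕ) :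
    defect δ l v (N + 1) =
      defect δ (l - 1) v (N + 1) + contigCoeff δ l * defect δ (l + 1) v N := by
  have hl (n : ℕ) := propCoeff_contiguous δ
    (fun m e => (h (-m)).1 (by push_cast; exact e) : ∀ m : ℕ, l ≠ -m) n
  have ha (k n : ℕ) := propCoeff_contiguous δ
    (fun m e => (h (-m - 2 * k)).2.2.2 (by push_cast; linarith) :
      ∀ m : ℕ, δ + l + v + 2 * k ≠ -m) n
  have hL : ∑ p ∈ Finset.HasAntidiagonal.antidiagonal (N + 1),
        propCoeff δ l p.1 * propCoeff δ v p.2 =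
      ∑ p ∈ Finset.HasAntidiagonal.antidiagonal (N + 1),
        propCoeff δ (l - 1) p.1 * propCoeff δ v p.2 +
      contigCoeff δ l *
        ∑ p ∈ Finset.HasAntidiagonal.antidiagonal N,
          propCoeff δ (l + 1) p.1 * propCoeff δ v p.2 := by
    rw [Finset.Nat.sum_antidiagonal_succ, Finset.Nat.sum_antidiagonal_succ, Finset.mul_sum,
      add_assoc, ← Finset.sum_add_distrib]
    simp only [propCoeff_zero]
    congr 1
    refine Finset.sum_congr rfl fun p _ => ?_
    rw [hl]; ring
  have hR : ∑ p ∈ Finset.HasAntidiagonal.antidiagonal (N + 1),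
        klCoeff δ l v p.1 * propCoeff δ (δ + l + v + 2 * p.1) p.2 =
      ∑ p ∈ Finset.HasAntidiagonal.antidiagonal (N + 1),
        klCoeff δ l v p.1 * propCoeff δ (δ + l + v + 2 * p.1 - 1) p.2 +
      ∑ p ∈ Finset.HasAntidiagonal.antidiagonal N,
        klCoeff δ l v p.1 * contigCoeff δ (δ + l + v + 2 * p.1) *
          propCoeff δ (δ + l + v + 2 * p.1 + 1) p.2 := by
    rw [Finset.Nat.sum_antidiagonal_succ', Finset.Nat.sum_antidiagonal_succ']
    simp only [propCoeff_zero, mul_one]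
    rw [add_assoc (klCoeff δ l v (N + 1)), ← Finset.sum_add_distrib]
    congr 1
    refine Finset.sum_congr rfl fun p _ => ?_
    rw [ha]; ring
  rw [defect, hL, hR, defect, defect, Finset.Nat.sum_antidiagonal_succ
    (f := fun p => klCoeff δ l v p.1 * propCoeff δ (δ + l + v + 2 * p.1 - 1) p.2),
    Finset.Nat.sum_antidiagonal_succ (f := fun p =>
      klCoeff δ (l - 1) v p.1 * propCoeff δ (δ + (l - 1) + v + 2 * p.1) p.2)]
  have key : ∑ p ∈ Finset.HasAntidiagonal.antidiagonal N, klCoeff δ l v (p.1 + 1) *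
        propCoeff δ (δ + l + v + 2 * (p.1 + 1 : ℕ) - 1) p.2 +
      ∑ p ∈ Finset.HasAntidiagonal.antidiagonal N,
        klCoeff δ l v p.1 * contigCoeff δ (δ + l + v + 2 * p.1) *
          propCoeff δ (δ + l + v + 2 * p.1 + 1) p.2 =
      ∑ p ∈ Finset.HasAntidiagonal.antidiagonal N, klCoeff δ (l - 1) v (p.1 + 1) *
        propCoeff δ (δ + (l - 1) + v + 2 * (p.1 + 1 : ℕ)) p.2 +
      contigCoeff δ l * ∑ p ∈ Finset.HasAntidiagonal.antidiagonal N,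
        klCoeff δ (l + 1) v p.1 * propCoeff δ (δ + (l + 1) + v + 2 * p.1) p.2 := by
    rw [Finset.mul_sum, ← Finset.sum_add_distrib, ← Finset.sum_add_distrib]
    refine Finset.sum_congr rfl fun p _ => ?_
    rw [show δ + l + v + 2 * ((p.1 + 1 : ℕ) : ℝ) - 1 = δ + l + v + 2 * p.1 + 1 by push_cast; ring,
      show δ + (l - 1) + v + 2 * ((p.1 + 1 : ℕ) : ℝ) = δ + l + v + 2 * p.1 + 1 by push_cast; ring,
      show δ + (l + 1) + v + 2 * (p.1 : ℝ) = δ + l + v + 2 * p.1 + 1 by ring]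
    linear_combination propCoeff δ (δ + l + v + 2 * p.1 + 1) p.2 * klCoeff_contiguous h p.1
  simp only [klCoeff_zero, one_mul]
  rw [show δ + l + v + 2 * ((0 : ℕ) : ℝ) - 1 = δ + (l - 1) + v + 2 * ((0 : ℕ) : ℝ) by ring]
  linear_combination -key

/-- Functions `ℝ → ℝ` given by a polynomial. -/
def IsPolyFun (f : ℝ → ℝ) : Prop := ∃ p : Polynomial ℝ, ∀ x, f x = p.eval x

namespace IsPolyFun

lemma const (c : ℝ) : IsPolyFun fun _ => c := ⟨Polynomial.C c, by simp⟩

lemma id : IsPolyFun fun x => x := ⟨Polynomial.X, by simp⟩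

variable {f g : ℝ → ℝ}

lemma add : IsPolyFun f → IsPolyFun g → IsPolyFun fun x => f x + g x
  | ⟨p, hp⟩, ⟨q, hq⟩ => ⟨p + q, by simp [hp, hq]⟩

lemma sub : IsPolyFun f → IsPolyFun g → IsPolyFun fun x => f x - g x
  | ⟨p, hp⟩, ⟨q, hq⟩ => ⟨p - q, by simp [hp, hq]⟩

lemma mul : IsPolyFun f → IsPolyFun g → IsPolyFun fun x => f x * g x
  | ⟨p, hp⟩, ⟨q, hq⟩ => ⟨p * q, by simp [hp, hq]⟩

lemma comp_poch (n : ℕ) : IsPolyFun f → IsPolyFun fun x => poch (f x) n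
  | ⟨p, hp⟩ => ⟨(ascPochhammer ℝ n).comp p, by simp [hp, poch]⟩

lemma sum {ι : Type*} (s : Finset ι) {F : ι → ℝ → ℝ} (h : ∀ i, IsPolyFun (F i)) :
    IsPolyFun fun x => ∑ i ∈ s, F i x := by
  choose p hp using h
  exact ⟨∑ i ∈ s, p i, fun x => by simp [Polynomial.eval_finsetSum, hp]⟩

lemma eq_zero (hf : IsPolyFun f) (h : {x | f x = 0}.Infinite) (x : ℝ) : f x = 0 := by
  obtain ⟨p, hp⟩ := hf
  have : p = 0 := Polynomial.eq_zero_of_infinite_isRoot p (by simpa [Polynomial.IsRoot, hp] using h)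
  simp [hp, this]

end IsPolyFun

lemma isPolyFun_clearedDefect (δ v : ℝ) (N : ℕ) : IsPolyFun fun l => clearedDefect δ l v N := by
  unfold clearedDefect
  refine .sub (.sum _ fun p => ?_) (.sum _ fun p => ?_) <;>
  repeat' first
    | exact .const _
    | exact .id
    | apply IsPolyFun.comp_poch
    | apply IsPolyFun.mul
    | apply IsPolyFun.add

lemma clearedDefect_eq_zero_of_generic {δ v : ℝ} (h : Generic δ (-δ) v) {N : ℕ}
    (ih : ∀ l, clearedDefect δ l v N = 0) (l : ℝ) : clearedDefect δ l v (N + 1) = 0 := by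
  have hg (n : ℤ) : Generic δ (-δ + n) v := h.add_int n
  have cleared {l : ℝ} (hl : Generic δ l v) (M : ℕ) :
      clearedDefect δ l v M = 0 ↔ defect δ l v M = 0 := by
    have h1 (m : ℕ) : l + 1 ≠ -m := fun e => (hl (-m - 1)).1 (by push_cast; linarith)
    have h2 (m : ℕ) : v + 1 ≠ -m := fun e => (hl (-m - 1)).2.1 (by push_cast; linarith)
    have h3 (m : ℕ) : δ + l + v ≠ -m := fun e => (hl (-m)).2.2.2 (by push_cast; linarith)
    rw [clearedDefect_eq h1 h2 h3]
    simp [poch_ne_zero h1, poch_ne_zero h2, poch_ne_zero h3]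
  have hz (n : ℕ) : defect δ (-δ - n) v (N + 1) = 0 := by
    induction n with
    | zero => simpa using defect_neg δ v (N + 1)
    | succ n hn =>
      have g0 : Generic δ (-δ - n) v := by simpa [sub_eq_add_neg] using hg (-n)
      have g1 : Generic δ (-δ - n + 1) v := by simpa using g0.add_int 1
      have := defect_succ g0 N
      rw [hn, (cleared g1 N).1 (ih _), mul_zero, add_zero] at this
      rw [this]; push_cast; ring_nf
  refine (isPolyFun_clearedDefect δ v (N + 1)).eq_zero ?_ l
  refine Set.infinite_of_injective_forall_mem (f := fun n : ℕ => -δ - n)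
    (fun a b hab => by simpa using hab) fun n => ?_
  refine (cleared ?_ _).2 (hz n)
  simpa [sub_eq_add_neg] using hg (-n)

lemma clearedDefect_eq_zero (N : ℕ) (δ l v : ℝ) : clearedDefect δ l v N = 0 := by
  induction N generalizing δ l v with
  | zero => simp [clearedDefect, poch_succ]
  | succ N ih =>
    let f : ℝ → ℝ := fun ε => clearedDefect (δ + ε) l (v + 2 * ε) (N + 1)
    have hf : Continuous f := by
      have (n : ℕ) {g : ℝ → ℝ} (hg : Continuous g) : Continuous fun x => poch (g x) n :=
        (continuous_poch n).comp hg
      unfold f clearedDefect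
      fun_prop
    let S : Set ℝ := ⋃ m : ℤ, {-δ - m, (m - v) / 2, m + δ - v}
    have hS : Dense Sᶜ := (Set.countable_iUnion fun m => by
      simp only [Set.countable_insert, Set.countable_singleton]).dense_compl ℝ
    have hzero : Set.EqOn f (fun _ => 0) Sᶜ := by
      intro ε hε
      refine clearedDefect_eq_zero_of_generic (fun m => ?_) (fun l => ih _ _ _) l
      simp only [S, Set.mem_compl_iff, Set.mem_iUnion, Set.mem_insert_iff,
        Set.mem_singleton_iff, not_exists, not_or] at hε
      obtain ⟨h1, h2, h3⟩ := hε m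
      exact ⟨fun e => h1 (by linarith), fun e => h2 (by linarith), fun e => h3 (by linarith),
        fun e => h2 (by linarith)⟩
    have := congrFun (hf.ext_on hS continuous_const hzero) 0
    simpa [f] using this

lemma sum_propCoeff_mul_propCoeff {δ l v : ℝ} (hl : ∀ m : ℕ, l + 1 ≠ -m)
    (hv : ∀ m : ℕ, v + 1 ≠ -m) (ha : ∀ m : ℕ, δ + l + v ≠ -m) (N : ℕ) :
    ∑ p ∈ Finset.HasAntidiagonal.antidiagonal N, propCoeff δ l p.1 * propCoeff δ v p.2 =
      ∑ p ∈ Finset.HasAntidiagonal.antidiagonal N,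
        klCoeff δ l v p.1 * propCoeff δ (δ + l + v + 2 * p.1) p.2 := by
  have h := clearedDefect_eq hl hv ha N
  rw [clearedDefect_eq_zero, eq_comm, mul_eq_zero] at h
  simp only [mul_eq_zero, poch_ne_zero hl, poch_ne_zero hv, poch_ne_zero ha, or_self,
    false_or] at h
  exact sub_eq_zero.1 h

lemma summable_propCoeff_mul_pow {δ μ y : ℝ} (h1 : ∀ m : ℕ, δ + μ ≠ -m)
    (h2 : ∀ m : ℕ, μ + 1 ≠ -m) (hy0 : 0 ≤ y) (hy1 : 4 * y < 1) :
    Summable fun n => propCoeff δ μ n * y ^ n := by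
  have hr := ordinaryHypergeometricSeries_radius_eq_one ℝ ((δ + μ) / 2) ((δ + μ + 1) / 2) (μ + 1)
    fun m => ⟨fun e => h1 (2 * m) (by push_cast; linarith),
      fun e => h1 (2 * m + 1) (by push_cast; linarith), fun e => h2 m (by linarith)⟩
  have hmem : 4 * y ∈ Metric.eball (0 : ℝ)
      (ordinaryHypergeometricSeries ℝ ((δ + μ) / 2) ((δ + μ + 1) / 2) (μ + 1)).radius := by
    rw [hr, Metric.mem_eball, edist_zero_right, ← ofReal_norm, Real.norm_eq_abs,
      abs_of_nonneg (by positivity), ENNReal.ofReal_lt_one]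
    exact hy1
  have hs := (FormalMultilinearSeries.summable_norm_apply _ hmem).of_norm
  refine hs.congr fun n => ?_
  rw [ordinaryHypergeometricSeries_apply_eq, propCoeff, poch_two_mul]
  simp only [poch, smul_eq_mul, mul_pow, div_eq_mul_inv, mul_inv]
  ring

section DoubleSeries

variable {F : ℕ × ℕ → ℝ}

lemma summable_of_summable_sum_antidiagonal (hF : ∀ p, 0 ≤ F p)
    (h : Summable fun N => ∑ p ∈ Finset.HasAntidiagonal.antidiagonal N, F p) : Summable F := by
  rw [← Finset.HasAntidiagonal.sigmaAntidiagonalEquivProd.summable_iff]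
  refine (summable_sigma_of_nonneg
    (f := F ∘ ⇑Finset.HasAntidiagonal.sigmaAntidiagonalEquivProd) fun _ => hF _).2
    ⟨fun N => (hasSum_fintype _).summable, h.congr fun N => ?_⟩
  rw [tsum_fintype, ← Finset.sum_finset_coe]
  rfl

lemma Summable.hasSum_sum_antidiagonal (h : Summable F) :
    HasSum (fun N => ∑ p ∈ Finset.HasAntidiagonal.antidiagonal N, F p) (∑' p, F p) := by
  have h1 := (Finset.HasAntidiagonal.sigmaAntidiagonalEquivProd.hasSum_iff.2 h.hasSum).sigma
    fun N => hasSum_fintype _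
  refine h1.congr_fun fun N => ?_
  rw [← Finset.sum_finset_coe]
  rfl

/-- A double series whose rows converge, all but finitely many of which are nonnegative, is summable
as soon as its sums along antidiagonals are. -/
lemma summable_of_eventually_nonneg (hrow : ∀ k, Summable fun n => F (k, n))
    (hpos : ∀ᶠ k in atTop, ∀ n, 0 ≤ F (k, n))
    (h : Summable fun N => ∑ p ∈ Finset.HasAntidiagonal.antidiagonal N, F p) : Summable F := by
  have hG : Summable fun p => |F p| - F p := by
    rw [summable_prod_of_nonneg fun p => sub_nonneg.2 (le_abs_self _)]
    refine ⟨fun k => (hrow k).abs.sub (hrow k), ?_⟩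
    obtain ⟨K, hK⟩ := eventually_atTop.1 hpos
    refine summable_of_ne_finset_zero (s := Finset.range K) fun k hk => ?_
    have hk' : K ≤ k := by simpa using hk
    simp [abs_of_nonneg (hK k hk' _)]
  refine Summable.of_abs (summable_of_summable_sum_antidiagonal (fun _ => abs_nonneg _) ?_)
  refine (hG.hasSum_sum_antidiagonal.summable.add h).congr fun N => ?_
  simp

end DoubleSeries

/-- The sequence is eventually nonnegative or eventually nonpositive. -/
def EventuallySigned (f : ℕ → ℝ) : Prop :=
  (∀ᶠ k in atTop, 0 ≤ f k) ∨ ∀ᶠ k in atTop, f k ≤ 0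

namespace EventuallySigned

variable {f g : ℕ → ℝ}

lemma mul (hf : EventuallySigned f) (hg : EventuallySigned g) :
    EventuallySigned fun k => f k * g k := by
  rcases hf with hf | hf <;> rcases hg with hg | hg
  · exact .inl (by filter_upwards [hf, hg] with k a b using mul_nonneg a b)
  · exact .inr (by filter_upwards [hf, hg] with k a b using mul_nonpos_of_nonneg_of_nonpos a b)
  · exact .inr (by filter_upwards [hf, hg] with k a b using mul_nonpos_of_nonpos_of_nonneg a b)
  · exact .inl (by filter_upwards [hf, hg] with k a b using mul_nonneg_of_nonpos_of_nonpos a b)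

lemma inv (hf : EventuallySigned f) : EventuallySigned fun k => (f k)⁻¹ :=
  hf.imp (fun h => h.mono fun _ => inv_nonneg.2) fun h => h.mono fun _ => inv_nonpos.2

lemma div (hf : EventuallySigned f) (hg : EventuallySigned g) :
    EventuallySigned fun k => f k / g k := by
  simpa only [div_eq_mul_inv] using hf.mul hg.inv

lemma poch_const (x : ℝ) : EventuallySigned fun k => poch x k := by
  obtain ⟨K, hK⟩ := exists_nat_gt (-x)
  have hx : 0 < x + K := by linarith
  have key (k : ℕ) (hk : K ≤ k) : poch x k = poch x K * poch (x + K) (k - K) := by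
    rw [← poch_add, Nat.add_sub_cancel' hk]
  rcases le_total 0 (poch x K) with h | h
  · left
    filter_upwards [eventually_ge_atTop K] with k hk
    rw [key k hk]
    exact mul_nonneg h (poch_pos hx _).le
  · right
    filter_upwards [eventually_ge_atTop K] with k hk
    rw [key k hk]
    exact mul_nonpos_of_nonpos_of_nonneg h (poch_pos hx _).le

lemma poch_add_natCast (x : ℝ) : EventuallySigned fun k => poch (x + k) k := by
  obtain ⟨K, hK⟩ := exists_nat_gt (-x)
  left
  filter_upwards [eventually_ge_atTop K] with k hk
  have : (K : ℝ) ≤ k := by exact_mod_cast hk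
  exact (poch_pos (by linarith) _).le

lemma klCoeff (δ l v : ℝ) : EventuallySigned (klCoeff δ l v) :=
  have hfac : EventuallySigned fun k => (k.factorial : ℝ) :=
    .inl (Eventually.of_forall fun k => by positivity)
  ((((poch_const _).mul (poch_const _)).mul (poch_const _)).mul (poch_add_natCast _)).div
    (((hfac.mul (poch_const _)).mul (poch_const _)).mul
      (poch_add_natCast _))

end EventuallySigned

lemma propCoeff_nonneg {δ μ : ℝ} (h1 : 0 < δ + μ) (h2 : 0 < μ + 1) (n : ℕ) :
    0 ≤ propCoeff δ μ n :=
  div_nonneg (poch_pos h1 _).le (mul_nonneg (poch_pos h2 _).le (by positivity))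

lemma eventually_propCoeff_nonneg (δ a : ℝ) :
    ∀ᶠ k : ℕ in atTop, ∀ n, 0 ≤ propCoeff δ (a + 2 * k) n := by
  obtain ⟨K, hK⟩ := exists_nat_gt (|δ| + |a|)
  filter_upwards [eventually_ge_atTop K] with k hk n
  have h : (K : ℝ) ≤ k := by exact_mod_cast hk
  have := neg_abs_le δ
  have := neg_abs_le a
  have := abs_nonneg δ
  exact propCoeff_nonneg (by linarith) (by linarith) n

/-- The terms of the expansion, as a double series. -/
noncomputable def klTerm (δ l v y : ℝ) (p : ℕ × ℕ) : ℝ :=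
  klCoeff δ l v p.1 * y ^ p.1 * (propCoeff δ (δ + l + v + 2 * p.1) p.2 * y ^ p.2)

lemma sum_antidiagonal_klTerm {δ l v : ℝ} (y : ℝ) (h4 : ∀ m : ℕ, δ + l + v ≠ -m)
    (h6 : ∀ m : ℕ, l + 1 ≠ -m) (h7 : ∀ m : ℕ, v + 1 ≠ -m) (N : ℕ) :
    ∑ p ∈ Finset.HasAntidiagonal.antidiagonal N,
      propCoeff δ l p.1 * y ^ p.1 * (propCoeff δ v p.2 * y ^ p.2) =
      ∑ p ∈ Finset.HasAntidiagonal.antidiagonal N, klTerm δ l v y p := by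
  have e := congrArg (· * y ^ N) (sum_propCoeff_mul_propCoeff h6 h7 h4 N)
  simp only [Finset.sum_mul] at e
  refine (Finset.sum_congr rfl fun p hp => ?_).trans
    (e.trans (Finset.sum_congr rfl fun p hp => ?_)) <;>
    rw [← (Finset.HasAntidiagonal.mem_antidiagonal.1 hp : p.1 + p.2 = N), pow_add]
  · ring
  · rw [klTerm]; ring

lemma summable_klTerm {δ l v y : ℝ} (hy0 : 0 ≤ y)
    (hrow : ∀ k, Summable fun n => klTerm δ l v y (k, n))
    (hanti : Summable fun N => ∑ p ∈ Finset.HasAntidiagonal.antidiagonal N, klTerm δ l v y p) :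
    Summable (klTerm δ l v y) := by
  rcases EventuallySigned.klCoeff δ l v with h | h
  · refine summable_of_eventually_nonneg hrow ?_ hanti
    filter_upwards [h, eventually_propCoeff_nonneg δ (δ + l + v)] with k hk hk' n
    exact mul_nonneg (mul_nonneg hk (pow_nonneg hy0 _)) (mul_nonneg (hk' n) (pow_nonneg hy0 _))
  · refine summable_neg_iff.1 (summable_of_eventually_nonneg (F := -klTerm δ l v y)
      (fun k => (hrow k).neg) ?_ ?_)
    · filter_upwards [h, eventually_propCoeff_nonneg δ (δ + l + v)] with k hk hk' n
      exact neg_nonneg.2 (mul_nonpos_of_nonpos_of_nonneg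
        (mul_nonpos_of_nonpos_of_nonneg hk (pow_nonneg hy0 _))
        (mul_nonneg (hk' n) (pow_nonneg hy0 _)))
    · simpa only [Pi.neg_apply, Finset.sum_neg_distrib] using hanti.neg

/-- The expansion in terms of normalized coefficients. -/
lemma hasSum_klCoeff_mul_tsum {δ l v y : ℝ} (h2 : ∀ m : ℕ, δ + l ≠ -m)
    (h3 : ∀ m : ℕ, δ + v ≠ -m) (h4 : ∀ m : ℕ, δ + l + v ≠ -m)
    (h5 : ∀ m : ℕ, 2 * δ + l + v ≠ -m) (h6 : ∀ m : ℕ, l + 1 ≠ -m) (h7 : ∀ m : ℕ, v + 1 ≠ -m)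
    (hy0 : 0 ≤ y) (hy1 : 4 * y < 1) :
    HasSum (fun k : ℕ => klCoeff δ l v k * y ^ k *
        ∑' n, propCoeff δ (δ + l + v + 2 * k) n * y ^ n)
      ((∑' n, propCoeff δ l n * y ^ n) * ∑' n, propCoeff δ v n * y ^ n) := by
  have hl := summable_propCoeff_mul_pow h2 h6 hy0 hy1
  have hv := summable_propCoeff_mul_pow h3 h7 hy0 hy1
  have ha (k : ℕ) : Summable fun n => propCoeff δ (δ + l + v + 2 * k) n * y ^ n :=
    summable_propCoeff_mul_pow (fun m e => h5 (2 * k + m) (by push_cast; linarith))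
      (fun m e => h4 (2 * k + 1 + m) (by push_cast; linarith)) hy0 hy1
  have hrow (k : ℕ) : HasSum (fun n => klTerm δ l v y (k, n))
      (klCoeff δ l v k * y ^ k * ∑' n, propCoeff δ (δ + l + v + 2 * k) n * y ^ n) := by
    simpa only [klTerm] using (ha k).hasSum.mul_left (klCoeff δ l v k * y ^ k)
  have hanti := sum_antidiagonal_klTerm y h4 h6 h7
  have hF : Summable (klTerm δ l v y) :=
    summable_klTerm hy0 (fun k => (hrow k).summable)
      ((summable_sum_mul_antidiagonal_of_summable_norm' hl.norm hl hv.norm hv).congr hanti)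
  have hval : ∑' p, klTerm δ l v y p =
      (∑' n, propCoeff δ l n * y ^ n) * ∑' n, propCoeff δ v n * y ^ n := by
    rw [tsum_mul_tsum_eq_tsum_sum_antidiagonal_of_summable_norm hl.norm hv.norm,
      ← hF.hasSum_sum_antidiagonal.tsum_eq]
    exact tsum_congr fun N => (hanti N).symm
  rw [← hval]
  exact hF.hasSum.prod_fiberwise hrow

/-- The propagator as a power series in `(2u)^(-2)`. -/
lemma adsG_eq (d μ : ℝ) {u : ℝ} (hu : 0 < u) :
    adsG d μ u = Real.Gamma ((d - 1) / 2 + μ) /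
      (2 * Real.pi ^ ((d - 1) / 2) * Real.Gamma (μ + 1) * (2 * u) ^ ((d - 1) / 2 + μ)) *
      ∑' n, propCoeff ((d - 1) / 2) μ n * (((2 * u) ^ 2)⁻¹) ^ n := by
  rw [adsG]
  congr 1
  refine tsum_congr fun n => ?_
  rw [propCoeff, poch_two_mul, show ((d - 1) / 2 + μ) / 2 = (d - 1) / 4 + μ / 2 by ring,
    show ((d - 1) / 2 + μ + 1) / 2 = (d + 1) / 4 + μ / 2 by ring, poch, poch, poch,
    show -(2 : ℝ) * n = -((2 * n : ℕ) : ℝ) by push_cast; ring, Real.rpow_neg hu.le,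
    Real.rpow_natCast, pow_mul, mul_pow, inv_pow, mul_pow, show (2 : ℝ) ^ 2 = 4 by norm_num]
  field_simp

lemma klWeight_mul_prefactor {d l v u : ℝ} (k : ℕ) (hd : 1 < d) (hu : 0 < u)
    (h1 : ∀ n : ℕ, l + v ≠ -n) (h2 : ∀ n : ℕ, (d - 1) / 2 + l ≠ -n)
    (h3 : ∀ n : ℕ, (d - 1) / 2 + v ≠ -n) (h4 : ∀ n : ℕ, (d - 1) / 2 + l + v ≠ -n)
    (h5 : ∀ n : ℕ, 2 * ((d - 1) / 2) + l + v ≠ -n) (h6 : ∀ n : ℕ, l + 1 ≠ -n)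
    (h7 : ∀ n : ℕ, v + 1 ≠ -n) :
    klWeight d k l v * (Real.Gamma ((d - 1) / 2 + ((d - 1) / 2 + 2 * k + l + v)) /
      (2 * Real.pi ^ ((d - 1) / 2) * Real.Gamma ((d - 1) / 2 + 2 * k + l + v + 1) *
        (2 * u) ^ ((d - 1) / 2 + ((d - 1) / 2 + 2 * k + l + v)))) =
    Real.Gamma ((d - 1) / 2 + l) /
      (2 * Real.pi ^ ((d - 1) / 2) * Real.Gamma (l + 1) * (2 * u) ^ ((d - 1) / 2 + l)) *
    (Real.Gamma ((d - 1) / 2 + v) /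
      (2 * Real.pi ^ ((d - 1) / 2) * Real.Gamma (v + 1) * (2 * u) ^ ((d - 1) / 2 + v))) *
    (klCoeff ((d - 1) / 2) l v k * (((2 * u) ^ 2)⁻¹) ^ k) := by
  have hδ : 0 < (d - 1) / 2 := by linarith
  rw [klWeight]
  generalize (d - 1) / 2 = δ at *
  have hw : 0 < 2 * u := by linarith
  have hδ' (m : ℕ) : δ ≠ -m := fun e => by
    have : (0 : ℝ) ≤ m := by positivity
    linarith
  have hs (m : ℕ) : l + v + 1 + k ≠ -m := fun e => h1 (1 + k + m) (by push_cast; linarith)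
  have ha (m : ℕ) : δ + l + v + k ≠ -m := fun e => h4 (k + m) (by push_cast; linarith)
  have ha2 : δ + l + v + k + k ≠ 0 := fun e => h4 (k + k) (by push_cast; linarith)
  have e1 : Real.Gamma (1 + 2 * k + l + v) =
      Real.Gamma (l + v + 1 + k) * poch (l + v + 1 + k) k := by
    rw [← Gamma_add_natCast hs]; ring_nf
  have e2 : Real.Gamma (2 * δ + 2 * k + l + v) = Real.Gamma (δ + (δ + 2 * k + l + v)) := by
    ring_nf
  have e3 : Real.Gamma (δ + 2 * k + l + v + 1) =
      (δ + l + v + k + k) * (Real.Gamma (δ + l + v + k) * poch (δ + l + v + k) k) := by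
    rw [← Gamma_add_natCast ha, ← Real.Gamma_add_one ha2]; ring_nf
  have e4 : Real.Gamma (1 + l + k) = Real.Gamma (l + 1) * poch (l + 1) k := by
    rw [← Gamma_add_natCast h6]; ring_nf
  have e5 : Real.Gamma (1 + v + k) = Real.Gamma (v + 1) * poch (v + 1) k := by
    rw [← Gamma_add_natCast h7]; ring_nf
  have e6 : Real.Gamma (1 + l + v + k) = Real.Gamma (l + v + 1 + k) := by ring_nf
  have e7 : Real.Gamma (1 + k) = k.factorial := by rw [add_comm, Real.Gamma_nat_eq_factorial]
  have e8 : (2 * u) ^ (δ + (δ + 2 * k + l + v)) =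
      (2 * u) ^ (δ + l) * (2 * u) ^ (δ + v) * ((2 * u) ^ 2) ^ k := by
    rw [← pow_mul, ← Real.rpow_natCast, ← Real.rpow_add hw, ← Real.rpow_add hw]
    push_cast; ring_nf
  have e9 : 2 * δ + 4 * k + 2 * l + 2 * v = 2 * (δ + l + v + k + k) := by ring
  have n1 : Real.Gamma (δ + (δ + 2 * k + l + v)) ≠ 0 :=
    Real.Gamma_ne_zero fun m e => h5 (2 * k + m) (by push_cast; linarith)
  have n2 := Real.Gamma_ne_zero ha
  have n3 := Real.Gamma_ne_zero hs
  have n4 := Real.Gamma_ne_zero hδ'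
  rw [e1, e2, e3, e4, e5, e6, e7, e8, e9, Gamma_add_natCast hδ', Gamma_add_natCast h2,
    Gamma_add_natCast h3, klCoeff, inv_pow]
  generalize Real.Gamma (δ + (δ + 2 * k + l + v)) = c1 at *
  generalize Real.Gamma (δ + l + v + k) = c2 at *
  generalize Real.Gamma (l + v + 1 + k) = c3 at *
  generalize δ + l + v + k + k = c4 at *
  have p1 := poch_ne_zero ha k
  have p2 := poch_ne_zero h6 k
  have p3 := poch_ne_zero h7 k
  have p4 := Real.Gamma_ne_zero h6
  have p5 := Real.Gamma_ne_zero h7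
  generalize poch (l + v + 1 + k) k = c5 at *
  generalize poch (δ + l + v + k) k = c6 at *
  field_simp
  ring

/-- Extended Källén–Lehmann expansion for the AdS bubble, valid without the positivity
conditions, assuming only that none of the relevant parameter combinations is a
nonpositive integer (and neither mass parameter is a negative integer). -/
theorem KL_expansion_extended (d lam nu : ℝ) (hd : 1 < d)
    (h1 : ∀ n : ℕ, lam + nu ≠ -(n : ℝ))
    (h2 : ∀ n : ℕ, (d - 1) / 2 + lam ≠ -(n : ℝ))
    (h3 : ∀ n : ℕ, (d - 1) / 2 + nu ≠ -(n : ℝ))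
    (h4 : ∀ n : ℕ, (d - 1) / 2 + lam + nu ≠ -(n : ℝ))
    (h5 : ∀ n : ℕ, 2 * ((d - 1) / 2) + lam + nu ≠ -(n : ℝ))
    (h6 : ∀ n : ℕ, lam ≠ -((n : ℝ) + 1))
    (h7 : ∀ n : ℕ, nu ≠ -((n : ℝ) + 1))
    (u : ℝ) (hu : 1 < u) :
    Summable (fun k : ℕ =>
      |klWeight d k lam nu * adsG d ((d - 1) / 2 + 2 * k + lam + nu) u|) ∧
    adsG d lam u * adsG d nu u =
      ∑' k : ℕ, klWeight d k lam nu * adsG d ((d - 1) / 2 + 2 * k + lam + nu) u := by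
  have h6' (m : ℕ) : lam + 1 ≠ -m := fun e => h6 m (by linarith)
  have h7' (m : ℕ) : nu + 1 ≠ -m := fun e => h7 m (by linarith)
  have hu0 : 0 < u := by linarith
  have hy : 4 * ((2 * u) ^ 2)⁻¹ < 1 := by
    rw [mul_inv_lt_iff₀ (by positivity)]
    nlinarith
  have hsum := (hasSum_klCoeff_mul_tsum h2 h3 h4 h5 h6' h7' (by positivity) hy).mul_left
    (Real.Gamma ((d - 1) / 2 + lam) /
      (2 * Real.pi ^ ((d - 1) / 2) * Real.Gamma (lam + 1) * (2 * u) ^ ((d - 1) / 2 + lam)) *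
    (Real.Gamma ((d - 1) / 2 + nu) /
      (2 * Real.pi ^ ((d - 1) / 2) * Real.Gamma (nu + 1) * (2 * u) ^ ((d - 1) / 2 + nu))))
  have hterm (k : ℕ) := klWeight_mul_prefactor k hd hu0 h1 h2 h3 h4 h5 h6' h7'
  have hmain : HasSum
      (fun k : ℕ => klWeight d k lam nu * adsG d ((d - 1) / 2 + 2 * k + lam + nu) u)
      (adsG d lam u * adsG d nu u) := by
    rw [adsG_eq d lam hu0, adsG_eq d nu hu0, mul_mul_mul_comm]
    refine hsum.congr_fun fun k => ?_
    rw [adsG_eq d _ hu0, ← mul_assoc, hterm k,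
      show (d - 1) / 2 + 2 * k + lam + nu = (d - 1) / 2 + lam + nu + 2 * k by ring, mul_assoc]
  exact ⟨hmain.summable.abs, hmain.tsum_eq.symm⟩
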